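/- Let X be a suffix of a string Y and also a suffix of a string Z. Let ρ_X, ρ_Y, ρ_Z denote the minimal periods of X, Y, Z respectively, and suppose ρ_X + ρ_Y ≤ |X| and ρ_X + ρ_Z ≤ |X|. Then Y is a suffix of Z or Z is a suffix of Y. -/

import Mathlib

/-- `U` occurs in `T` at position `q` (0-indexed): the substring of `T` of length
`|U|` starting at position `q` equals `U`. -/
def occursAt {α : Type*} (U T : List α) (q : ℕ) : Prop :=
  (T.drop q).take U.length = U

/-- `q` is a period of the string `x`. -/
def IsPeriod {α : Type*} (x : List α) (q : ℕ) : Prop :=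
  0 < q ∧ q ≤ x.length ∧ ∀ i, i + q < x.length → x[i]? = x[i + q]?

/-- The minimal period of `x`. -/
noncomputable def minPeriod {α : Type*} (x : List α) : ℕ :=
  sInf {q | IsPeriod x q}

theorem isPeriod_minPeriod {α : Type*} {x : List α} (hx : x ≠ []) :
    IsPeriod x (minPeriod x) :=
  Nat.sInf_mem (s := {q | IsPeriod x q})
    ⟨x.length, List.length_pos_iff.2 hx, le_rfl, fun i hi => by omega⟩

theorem IsPeriod.reverse {α : Type*} {x : List α} {q : ℕ} (h : IsPeriod x q) :
    IsPeriod x.reverse q := by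
  obtain ⟨h0, hle, h⟩ := h
  refine ⟨h0, by simpa using hle, fun i hi => ?_⟩
  rw [List.length_reverse] at hi
  rw [List.getElem?_reverse (by omega), List.getElem?_reverse hi]
  have := h (x.length - 1 - (i + q)) (by omega)
  rw [show x.length - 1 - (i + q) + q = x.length - 1 - i by omega] at this
  exact this.symm

theorem List.IsPrefix.getElem?_eq_of_lt {α : Type*} {x y : List α} (h : x <+: y) {i : ℕ}
    (hi : i < x.length) : y[i]? = x[i]? := by
  rw [List.prefix_iff_getElem?.1 h i hi, List.getElem?_eq_getElem hi]

/-- A period of a prefix extends to the whole string when the prefix is long enough compared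
with some period of the whole string. -/
theorem IsPeriod.of_prefix {α : Type*} {x y : List α} {p q : ℕ} (hxy : x <+: y)
    (hp : IsPeriod x p) (hq : IsPeriod y q) (hpq : p + q ≤ x.length) : IsPeriod y p := by
  have hlen := hxy.length_le
  refine ⟨hp.1, by omega, fun i => ?_⟩
  induction i using Nat.strong_induction_on with
  | _ i ih =>
    intro hi
    have hq0 := hq.1
    by_cases hix : i + p < x.length
    · rw [hxy.getElem?_eq_of_lt (by omega), hxy.getElem?_eq_of_lt hix]
      exact hp.2.2 i hix
    · have h₁ := hq.2.2 (i - q) (by omega)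
      have h₂ := hq.2.2 (i - q + p) (by omega)
      rw [show i - q + q = i by omega] at h₁
      rw [show i - q + p + q = i + p by omega] at h₂
      rw [← h₁, ← h₂]
      exact ih (i - q) (by omega) (by omega)

/-- Two strings with a common period and a common prefix at least as long as that period are
comparable for the prefix order. -/
theorem IsPeriod.prefix_of_length_le {α : Type*} {x y z : List α} {p : ℕ} (hxy : x <+: y)
    (hxz : x <+: z) (hy : IsPeriod y p) (hz : IsPeriod z p) (hp : p ≤ x.length)
    (hlen : y.length ≤ z.length) : y <+: z := by
  have key : ∀ i, i < y.length → z[i]? = y[i]? := by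
    intro i
    induction i using Nat.strong_induction_on with
    | _ i ih =>
      intro hi
      have hp0 := hy.1
      by_cases hix : i < x.length
      · rw [hxy.getElem?_eq_of_lt hix, hxz.getElem?_eq_of_lt hix]
      · have h₁ := hy.2.2 (i - p) (by omega)
        have h₂ := hz.2.2 (i - p) (by omega)
        rw [show i - p + p = i by omega] at h₁ h₂
        rw [← h₁, ← h₂]
        exact ih (i - p) (by omega) (by omega)
  refine List.prefix_iff_getElem?.2 fun i hi => ?_
  rw [key i hi, List.getElem?_eq_getElem hi]

theorem common_suffix_chain {α : Type*} (X Y Z : List α)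
    (hXY : X <:+ Y) (hXZ : X <:+ Z)
    (hY : minPeriod X + minPeriod Y ≤ X.length)
    (hZ : minPeriod X + minPeriod Z ≤ X.length) :
    Y <:+ Z ∨ Z <:+ Y := by
  by_cases hY0 : Y = []
  · exact Or.inl (hY0 ▸ List.nil_suffix)
  by_cases hZ0 : Z = []
  · exact Or.inr (hZ0 ▸ List.nil_suffix)
  have pY := isPeriod_minPeriod hY0
  have pZ := isPeriod_minPeriod hZ0
  have hX0 : X ≠ [] := List.length_pos_iff.1 (by have := pY.1; omega)
  have pX := (isPeriod_minPeriod hX0).reverse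
  rw [← List.reverse_prefix] at hXY hXZ
  have qY := pX.of_prefix hXY pY.reverse (by simpa using hY)
  have qZ := pX.of_prefix hXZ pZ.reverse (by simpa using hZ)
  rw [← List.reverse_prefix, ← List.reverse_prefix]
  rcases le_total Y.reverse.length Z.reverse.length with h | h
  · exact Or.inl (qY.prefix_of_length_le hXY hXZ qZ pX.2.1 h)
  · exact Or.inr (qZ.prefix_of_length_le hXZ hXY qY pX.2.1 h)
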